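/- Let d ≥ 1 and n ≥ 1 be integers and K > 0. Let c : ℝᵈ → ℝᵈ be n times continuously differentiable with all partial derivatives up to order n (including c itself) bounded in absolute value by K, and suppose |det(𝕀 + θ·Dc(x))| ≥ K⁻¹ for all x ∈ ℝᵈ and θ ∈ [0,1]. For θ ∈ [0,1] let J_θ denote the inverse of the diffeomorphism T_θ(x) := x + θ·c(x). Then there exists a constant N depending only on n, d and K such that for every θ ∈ [0,1]: (i) every partial derivative ∂^ζ J_θ^j with 1 ≤ |ζ| ≤ n and 1 ≤ j ≤ d is bounded in absolute value by N on ℝᵈ, and (ii) |det DJ_θ(x)| ≤ K for all x ∈ ℝᵈ. -/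

import Mathlib

open MeasureTheory Finset
open scoped ENNReal

/-- Partial derivative in direction `i`. -/
noncomputable def pd {d : ℕ} (i : Fin d) (f : EuclideanSpace ℝ (Fin d) → ℝ) :
    EuclideanSpace ℝ (Fin d) → ℝ :=
  fun x => fderiv ℝ f x (EuclideanSpace.single i 1)

/-- Multi-index partial derivative `∂^ζ`. -/
noncomputable def mpd {d : ℕ} (ζ : Fin d → ℕ) (f : EuclideanSpace ℝ (Fin d) → ℝ) :
    EuclideanSpace ℝ (Fin d) → ℝ :=
  (List.finRange d).foldr (fun i g => (pd i)^[ζ i] g) f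

/-- Jacobian matrix of a map `ℝᵈ → ℝᵈ`. -/
noncomputable def jac {d : ℕ} (c : EuclideanSpace ℝ (Fin d) → EuclideanSpace ℝ (Fin d))
    (x : EuclideanSpace ℝ (Fin d)) : Matrix (Fin d) (Fin d) ℝ :=
  Matrix.of fun i j => fderiv ℝ (fun y => c y i) x (EuclideanSpace.single j 1)

/-- The finite set of multi-indices `ζ ∈ ℕᵈ` with `|ζ| ≤ n`. -/
def midx (d n : ℕ) : Finset (Fin d → ℕ) :=
  (Finset.univ.image (fun f : Fin d → Fin (n + 1) => fun i => (f i : ℕ))).filter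
    (fun ζ => ∑ i, ζ i ≤ n)


section PartialDerivatives

variable {d : ℕ}

theorem mpd_eq_foldr (ζ : Fin d → ℕ) (f : EuclideanSpace ℝ (Fin d) → ℝ) :
    mpd ζ f = ((List.finRange d).flatMap fun i => List.replicate (ζ i) i).foldr pd f := by
  have hrep : ∀ (m : ℕ) (i : Fin d) (g : EuclideanSpace ℝ (Fin d) → ℝ),
      (List.replicate m i).foldr pd g = (pd i)^[m] g := by
    intro m i g
    induction m with
    | zero => rfl
    | succ m ih =>
      rw [List.replicate_succ, List.foldr_cons, ih, Function.iterate_succ_apply']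
  unfold mpd
  induction List.finRange d with
  | nil => rfl
  | cons i l ih => rw [List.foldr_cons, ih, List.flatMap_cons, List.foldr_append, hrep]

theorem count_flatMap_replicate (ζ : Fin d → ℕ) (a : Fin d) :
    ((List.finRange d).flatMap fun i => List.replicate (ζ i) i).count a = ζ a := by
  rw [List.count_flatMap, ← Fin.sum_univ_def]
  simp [List.count_replicate]

theorem length_flatMap_replicate (ζ : Fin d → ℕ) :
    ((List.finRange d).flatMap fun i => List.replicate (ζ i) i).length = ∑ i, ζ i := by
  rw [List.length_flatMap, Fin.sum_univ_def]
  simp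

theorem contDiff_pd {m : ℕ} {f : EuclideanSpace ℝ (Fin d) → ℝ} (hf : ContDiff ℝ (m + 1 : ℕ) f)
    (i : Fin d) : ContDiff ℝ m (pd i f) :=
  (hf.fderiv_right (m := m) (by norm_cast)).clm_apply contDiff_const

theorem contDiff_foldr_pd (l : List (Fin d)) {m : ℕ} {f : EuclideanSpace ℝ (Fin d) → ℝ}
    (hf : ContDiff ℝ (m + l.length : ℕ) f) : ContDiff ℝ m (l.foldr pd f) := by
  induction l generalizing m with
  | nil => exact hf
  | cons a l ih =>
    refine contDiff_pd (ih ?_) a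
    rwa [List.length_cons, ← add_assoc, add_right_comm] at hf

theorem pd_comm {f : EuclideanSpace ℝ (Fin d) → ℝ} (hf : ContDiff ℝ 2 f) (i j : Fin d) :
    pd i (pd j f) = pd j (pd i f) := by
  funext x
  have hd : DifferentiableAt ℝ (fderiv ℝ f) x :=
    (hf.fderiv_right (m := 1) (by norm_num)).differentiable one_ne_zero x
  have hs : IsSymmSndFDerivAt ℝ f x := hf.contDiffAt.isSymmSndFDerivAt (by simp)
  have key : ∀ a b : Fin d, pd a (pd b f) x =
      fderiv ℝ (fderiv ℝ f) x (EuclideanSpace.single a 1) (EuclideanSpace.single b 1) := by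
    intro a b
    unfold pd
    rw [fderiv_clm_apply hd (differentiableAt_const _)]
    simp
  rw [key, key, hs]

theorem foldr_pd_perm {l l' : List (Fin d)} (h : l.Perm l') {f : EuclideanSpace ℝ (Fin d) → ℝ}
    (hf : ContDiff ℝ l.length f) : l.foldr pd f = l'.foldr pd f := by
  induction h with
  | nil => rfl
  | cons a _ ih =>
    rw [List.foldr_cons, List.foldr_cons, ih (hf.of_le (by simp))]
  | swap a b l =>
    refine pd_comm (contDiff_foldr_pd (m := 2) l ?_) b a
    convert hf using 2
    simp only [List.length_cons]
    lia
  | trans h₁ _ ih₁ ih₂ => rw [ih₁ hf, ih₂ (h₁.length_eq ▸ hf)]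

theorem iteratedFDeriv_apply_single {k : ℕ} {f : EuclideanSpace ℝ (Fin d) → ℝ}
    (hf : ContDiff ℝ k f) (r : Fin k → Fin d) (x : EuclideanSpace ℝ (Fin d)) :
    iteratedFDeriv ℝ k f x (fun j => EuclideanSpace.single (r j) 1) =
      (List.ofFn r).foldr pd f x := by
  induction k generalizing x with
  | zero => simp
  | succ k ih =>
    have hd : DifferentiableAt ℝ (iteratedFDeriv ℝ k f) x :=
      hf.differentiable_iteratedFDeriv (by norm_cast; lia) x
    rw [hd.iteratedFDeriv_succ_apply_left', List.ofFn_succ, List.foldr_cons, pd]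
    congr 2
    funext y
    exact ih (hf.of_le (by norm_cast; lia)) (fun j => r j.succ) y

/-- Evaluating the `k`-th derivative on basis vectors gives a partial derivative of order `k`. -/
theorem exists_iteratedFDeriv_apply_single_eq_mpd {k : ℕ} {f : EuclideanSpace ℝ (Fin d) → ℝ}
    (hf : ContDiff ℝ k f) (r : Fin k → Fin d) :
    ∃ ζ : Fin d → ℕ, ∑ i, ζ i = k ∧ ∀ x,
      iteratedFDeriv ℝ k f x (fun j => EuclideanSpace.single (r j) 1) = mpd ζ f x := by
  set ζ : Fin d → ℕ := fun i => (List.ofFn r).count i with hζ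
  have hp : (List.ofFn r).Perm ((List.finRange d).flatMap fun i => List.replicate (ζ i) i) :=
    List.perm_iff_count.mpr fun a => (count_flatMap_replicate ζ a).symm
  refine ⟨ζ, ?_, fun x => ?_⟩
  · rw [← length_flatMap_replicate, ← hp.length_eq, List.length_ofFn]
  · rw [iteratedFDeriv_apply_single hf, mpd_eq_foldr, foldr_pd_perm hp (by simpa using hf)]

theorem abs_mpd_le_norm_iteratedFDeriv (ζ : Fin d → ℕ) {f : EuclideanSpace ℝ (Fin d) → ℝ}
    (hf : ContDiff ℝ (∑ i, ζ i : ℕ) f) (x : EuclideanSpace ℝ (Fin d)) :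
    |mpd ζ f x| ≤ ‖iteratedFDeriv ℝ (∑ i, ζ i) f x‖ := by
  rw [mpd_eq_foldr]
  rw [← length_flatMap_replicate] at hf ⊢
  set l := (List.finRange d).flatMap fun i => List.replicate (ζ i) i
  have h := iteratedFDeriv_apply_single hf l.get x
  rw [List.ofFn_get] at h
  rw [← h]
  simpa using (iteratedFDeriv ℝ l.length f x).le_opNorm fun j => EuclideanSpace.single (l.get j) 1

theorem norm_le_sum_abs (y : EuclideanSpace ℝ (Fin d)) : ‖y‖ ≤ ∑ i, |y i| := by
  conv_lhs => rw [← (EuclideanSpace.basisFun (Fin d) ℝ).sum_repr y]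
  refine (norm_sum_le _ _).trans (le_of_eq ?_)
  simp [norm_smul]

theorem opNorm_le_of_single {k : ℕ} {F : Type*} [NormedAddCommGroup F] [NormedSpace ℝ F]
    (A : EuclideanSpace ℝ (Fin d) [×k]→L[ℝ] F) {B : ℝ} (hB : 0 ≤ B)
    (h : ∀ r : Fin k → Fin d, ‖A fun j => EuclideanSpace.single (r j) 1‖ ≤ B) :
    ‖A‖ ≤ d ^ k * B := by
  refine A.opNorm_le_bound (by positivity) fun v => ?_
  have hv : v = fun j => ∑ i, v j i • EuclideanSpace.single i (1 : ℝ) := by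
    funext j
    simpa using ((EuclideanSpace.basisFun (Fin d) ℝ).sum_repr (v j)).symm
  conv_lhs => rw [hv, A.map_sum]
  calc _ ≤ ∑ r : Fin k → Fin d, ‖A fun j => v j (r j) • EuclideanSpace.single (r j) (1 : ℝ)‖ :=
        norm_sum_le _ _
    _ ≤ ∑ _r : Fin k → Fin d, (∏ j, ‖v j‖) * B := by
        refine sum_le_sum fun r _ => ?_
        rw [A.map_smul_univ, norm_smul, norm_prod]
        gcongr
        · exact PiLp.norm_apply_le _ _
        · exact h r
    _ = d ^ k * B * ∏ j, ‖v j‖ := by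
        simp
        ring

theorem iteratedFDeriv_coord {k : ℕ}
    {c : EuclideanSpace ℝ (Fin d) → EuclideanSpace ℝ (Fin d)} (hc : ContDiff ℝ k c) (i : Fin d)
    (x : EuclideanSpace ℝ (Fin d)) (v : Fin k → EuclideanSpace ℝ (Fin d)) :
    iteratedFDeriv ℝ k (fun y => c y i) x v = iteratedFDeriv ℝ k c x v i := by
  have := (EuclideanSpace.proj (𝕜 := ℝ) i).iteratedFDeriv_comp_left (x := x) hc.contDiffAt le_rfl
  exact congrArg (fun A => A v) this

theorem contDiff_coord {k : WithTop ℕ∞}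
    {c : EuclideanSpace ℝ (Fin d) → EuclideanSpace ℝ (Fin d)} (hc : ContDiff ℝ k c) (i : Fin d) :
    ContDiff ℝ k fun y => c y i :=
  (EuclideanSpace.proj (𝕜 := ℝ) i).contDiff.comp hc

theorem norm_iteratedFDeriv_le_of_mpd {n k : ℕ} (hk : k ≤ n) {K : ℝ} (hK : 0 ≤ K)
    {c : EuclideanSpace ℝ (Fin d) → EuclideanSpace ℝ (Fin d)} (hc : ContDiff ℝ n c)
    (h : ∀ ζ : Fin d → ℕ, (∑ i, ζ i) ≤ n → ∀ (i : Fin d) (x : EuclideanSpace ℝ (Fin d)),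
      |mpd ζ (fun y => c y i) x| ≤ K) (x : EuclideanSpace ℝ (Fin d)) :
    ‖iteratedFDeriv ℝ k c x‖ ≤ d ^ k * (d * K) := by
  have hck : ContDiff ℝ k c := hc.of_le (by exact_mod_cast hk)
  refine opNorm_le_of_single _ (by positivity) fun r => (norm_le_sum_abs _).trans ?_
  calc _ ≤ ∑ _i : Fin d, K := by
        refine sum_le_sum fun i _ => ?_
        rw [← iteratedFDeriv_coord hck]
        obtain ⟨ζ, hζ, e⟩ := exists_iteratedFDeriv_apply_single_eq_mpd (contDiff_coord hck i) r
        rw [e]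
        exact h ζ (hζ.trans_le hk) i x
    _ = d * K := by simp

theorem abs_mpd_coord_le (ζ : Fin d → ℕ)
    {c : EuclideanSpace ℝ (Fin d) → EuclideanSpace ℝ (Fin d)}
    (hc : ContDiff ℝ (∑ i, ζ i : ℕ) c) (i : Fin d) (x : EuclideanSpace ℝ (Fin d)) :
    |mpd ζ (fun y => c y i) x| ≤ ‖iteratedFDeriv ℝ (∑ i, ζ i) c x‖ := by
  refine (abs_mpd_le_norm_iteratedFDeriv ζ (contDiff_coord hc i) x).trans ?_
  refine ContinuousMultilinearMap.opNorm_le_bound (norm_nonneg _) fun v => ?_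
  rw [iteratedFDeriv_coord hc]
  exact (PiLp.norm_apply_le _ _).trans (ContinuousMultilinearMap.le_opNorm _ _)

theorem fderiv_coord {c : EuclideanSpace ℝ (Fin d) → EuclideanSpace ℝ (Fin d)}
    {x : EuclideanSpace ℝ (Fin d)} (hc : DifferentiableAt ℝ c x) (i : Fin d)
    (v : EuclideanSpace ℝ (Fin d)) : fderiv ℝ (fun y => c y i) x v = fderiv ℝ c x v i := by
  have := ((EuclideanSpace.proj (𝕜 := ℝ) i).hasFDerivAt.comp x hc.hasFDerivAt).fderiv
  exact congrArg (fun A => A v) this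

theorem det_jac {c : EuclideanSpace ℝ (Fin d) → EuclideanSpace ℝ (Fin d)}
    {x : EuclideanSpace ℝ (Fin d)} (hc : DifferentiableAt ℝ c x) :
    (jac c x).det = (fderiv ℝ c x).det := by
  rw [ContinuousLinearMap.det,
    ← LinearMap.det_toMatrix (EuclideanSpace.basisFun (Fin d) ℝ).toBasis]
  congr 1
  ext i j
  simp [jac, LinearMap.toMatrix_apply, fderiv_coord hc]

theorem jac_id_add_smul {c : EuclideanSpace ℝ (Fin d) → EuclideanSpace ℝ (Fin d)}
    {x : EuclideanSpace ℝ (Fin d)} (hc : DifferentiableAt ℝ c x) (θ : ℝ) :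
    jac (fun x => x + θ • c x) x = 1 + θ • jac c x := by
  have e : fderiv ℝ (fun x => x + θ • c x) x = 1 + θ • fderiv ℝ c x :=
    ((hasFDerivAt_id x).add (hc.hasFDerivAt.const_smul θ)).fderiv
  ext i j
  simp only [jac, Matrix.of_apply, Matrix.add_apply, Matrix.smul_apply]
  rw [fderiv_coord (by fun_prop), fderiv_coord hc, e]
  simp [Matrix.one_apply]

theorem norm_iteratedFDeriv_id_le {E : Type*} [NormedAddCommGroup E] [NormedSpace ℝ E] {k : ℕ}
    (hk : 1 ≤ k) (x : E) : ‖iteratedFDeriv ℝ k (fun y : E => y) x‖ ≤ 1 := by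
  obtain ⟨k, rfl⟩ := Nat.exists_eq_add_of_le' hk
  rw [← norm_iteratedFDeriv_fderiv, show fderiv ℝ (fun y : E => y) = fun _ => ContinuousLinearMap.id ℝ E from
    funext fun _ => fderiv_fun_id]
  rcases eq_or_ne k 0 with rfl | h
  · rw [norm_iteratedFDeriv_zero]
    exact ContinuousLinearMap.norm_id_le
  · simp [iteratedFDeriv_const_of_ne h]

theorem norm_iteratedFDeriv_id_add_smul_le {E : Type*} [NormedAddCommGroup E] [NormedSpace ℝ E]
    {k : ℕ} (hk : 1 ≤ k) {c : E → E} (hc : ContDiff ℝ k c) {θ : ℝ}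
    (hθ : θ ∈ Set.Icc (0 : ℝ) 1) (x : E) :
    ‖iteratedFDeriv ℝ k (fun x => x + θ • c x) x‖ ≤ 1 + ‖iteratedFDeriv ℝ k c x‖ := by
  rw [fun_iteratedFDeriv_add_apply (f := fun x : E => x) contDiffAt_id (hc.contDiffAt.const_smul θ),
    show (fun y => θ • c y) = θ • c from rfl, iteratedFDeriv_const_smul_apply hc.contDiffAt]
  refine (norm_add_le _ _).trans (add_le_add (norm_iteratedFDeriv_id_le hk x) ?_)
  rw [norm_smul, Real.norm_of_nonneg hθ.1]
  exact mul_le_of_le_one_left (norm_nonneg _) hθ.2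

end PartialDerivatives


section Inverse

variable {E : Type*} [NormedAddCommGroup E] [NormedSpace ℝ E]

theorem isOpen_det_ne_zero : IsOpen {A : E →L[ℝ] E | A.det ≠ 0} :=
  isOpen_ne_fun ContinuousLinearMap.continuous_det continuous_const

theorem fderiv_comp_fderiv_of_rightInverse {T J : E → E} (hT : Differentiable ℝ T)
    (hJ : Differentiable ℝ J) (hr : Function.RightInverse J T) (x : E) :
    fderiv ℝ T (J x) * fderiv ℝ J x = 1 := by
  have h : T ∘ J = id := funext hr
  have := fderiv_comp x (hT (J x)) (hJ x)
  rw [h, fderiv_id] at this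
  exact this.symm

theorem fderiv_eq_ringInverse {T J : E → E} (hT : Differentiable ℝ T)
    (hJ : Differentiable ℝ J) (hr : Function.RightInverse J T) (hl : Function.LeftInverse J T) :
    fderiv ℝ J = Ring.inverse ∘ (fderiv ℝ T ∘ J) := by
  funext x
  have h1 := fderiv_comp_fderiv_of_rightInverse hT hJ hr x
  have h2 := fderiv_comp_fderiv_of_rightInverse hJ hT hl (J x)
  rw [hr x] at h2
  exact (Ring.inverse_unit ⟨fderiv ℝ T (J x), fderiv ℝ J x, h1, h2⟩).symm

variable [FiniteDimensional ℝ E]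

theorem contDiffOn_ringInverse_det_ne_zero (m : ℕ) :
    ContDiffOn ℝ m (Ring.inverse : (E →L[ℝ] E) → (E →L[ℝ] E)) {A | A.det ≠ 0} := by
  have : CompleteSpace E := FiniteDimensional.complete ℝ E
  intro A hA
  have h := contDiffAt_ringInverse (n := m) ℝ
    ((ContinuousLinearEquiv.unitsEquiv ℝ E).symm (A.toContinuousLinearEquivOfDetNeZero hA))
  have e : (((ContinuousLinearEquiv.unitsEquiv ℝ E).symm
      (A.toContinuousLinearEquivOfDetNeZero hA) : (E →L[ℝ] E)ˣ) : E →L[ℝ] E) = A := by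
    ext x; rfl
  rw [e] at h
  exact h.contDiffWithinAt

/-- On linear maps of bounded norm whose determinant stays away from zero, the derivatives of
inversion are uniformly bounded. -/
theorem exists_bound_iteratedFDerivWithin_ringInverse (n : ℕ) (M : ℝ) {δ : ℝ} (hδ : 0 < δ) :
    ∃ C : ℝ, ∀ A : E →L[ℝ] E, ‖A‖ ≤ M → δ ≤ |A.det| → ∀ i ≤ n,
      ‖iteratedFDerivWithin ℝ i (Ring.inverse : (E →L[ℝ] E) → (E →L[ℝ] E))
        {A | A.det ≠ 0} A‖ ≤ C := by
  have hcomp : IsCompact {A : E →L[ℝ] E | ‖A‖ ≤ M ∧ δ ≤ |A.det|} := by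
    have hcl : IsClosed {A : E →L[ℝ] E | δ ≤ |A.det|} :=
      isClosed_le continuous_const ContinuousLinearMap.continuous_det.abs
    have : FiniteDimensional ℝ (E →L[ℝ] E) := inferInstance
    have : ProperSpace (E →L[ℝ] E) := FiniteDimensional.proper ℝ _
    have h := (isCompact_closedBall (0 : E →L[ℝ] E) M).inter_right hcl
    have e : Metric.closedBall (0 : E →L[ℝ] E) M ∩ {A | δ ≤ |A.det|} =
        {A | ‖A‖ ≤ M ∧ δ ≤ |A.det|} :=
      Set.ext fun A => and_congr_left' mem_closedBall_zero_iff
    rwa [e] at h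
  have hex : ∀ i : ℕ, ∃ C : ℝ, ∀ A ∈ {A : E →L[ℝ] E | ‖A‖ ≤ M ∧ δ ≤ |A.det|},
      ‖iteratedFDerivWithin ℝ i (Ring.inverse : (E →L[ℝ] E) → (E →L[ℝ] E))
        {A | A.det ≠ 0} A‖ ≤ C := fun i =>
    hcomp.exists_bound_of_continuousOn
      (((contDiffOn_ringInverse_det_ne_zero i).continuousOn_iteratedFDerivWithin le_rfl
        isOpen_det_ne_zero.uniqueDiffOn).mono fun A hA =>
          abs_pos.mp (hδ.trans_le hA.2))
  choose C hC using hex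
  refine ⟨∑ i ∈ range (n + 1), |C i|, fun A hA hA' i hi => ?_⟩
  calc _ ≤ C i := hC i A ⟨hA, hA'⟩
    _ ≤ |C i| := le_abs_self _
    _ ≤ _ := single_le_sum (f := fun i => |C i|) (fun _ _ => abs_nonneg _)
      (mem_range.mpr (by lia))

theorem contDiff_of_inverse {n : ℕ} (hn : 1 ≤ n) {T J : E → E} (hT : ContDiff ℝ n T)
    (hdet : ∀ x, (fderiv ℝ T x).det ≠ 0) (hl : Function.LeftInverse J T)
    (hr : Function.RightInverse J T) : ContDiff ℝ n J := by
  have : CompleteSpace E := FiniteDimensional.complete ℝ E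
  have hn' : (n : WithTop ℕ∞) ≠ 0 := by exact_mod_cast (by lia : n ≠ 0)
  have hopen : IsOpenMap T := by
    refine isOpenMap_of_hasStrictFDerivAt_equiv
      (f' := fun x => (fderiv ℝ T x).toContinuousLinearEquivOfDetNeZero (hdet x)) fun x => ?_
    rw [ContinuousLinearMap.coe_toContinuousLinearEquivOfDetNeZero]
    exact hT.contDiffAt.hasStrictFDerivAt hn'
  let e : E ≃ₜ E := Equiv.toHomeomorphOfContinuousOpen ⟨T, J, hl, hr⟩ hT.continuous hopen
  refine e.contDiff_symm
    (f₀' := fun x => (fderiv ℝ T x).toContinuousLinearEquivOfDetNeZero (hdet x)) (fun x => ?_) hT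
  rw [ContinuousLinearMap.coe_toContinuousLinearEquivOfDetNeZero]
  exact (hT.differentiable hn' x).hasFDerivAt

/-- The derivatives of the inverse of a diffeomorphism are bounded in terms of the derivatives of
the diffeomorphism and a lower bound for its Jacobian determinant. -/
theorem exists_bound_iteratedFDeriv_inverse (n : ℕ) (M : ℝ) {δ : ℝ} (hδ : 0 < δ) :
    ∃ N : ℝ, ∀ T J : E → E, ContDiff ℝ n T →
      (∀ i, 1 ≤ i → i ≤ n → ∀ x, ‖iteratedFDeriv ℝ i T x‖ ≤ M) →
      (∀ x, δ ≤ |(fderiv ℝ T x).det|) →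
      Function.LeftInverse J T → Function.RightInverse J T →
      ∀ i, 1 ≤ i → i ≤ n → ∀ x, ‖iteratedFDeriv ℝ i J x‖ ≤ N := by
  obtain ⟨C, hC⟩ := exists_bound_iteratedFDerivWithin_ringInverse (E := E) n M hδ
  suffices h : ∀ k ≤ n, ∃ N : ℝ, ∀ T J : E → E, ContDiff ℝ n T →
      (∀ i, 1 ≤ i → i ≤ n → ∀ x, ‖iteratedFDeriv ℝ i T x‖ ≤ M) →
      (∀ x, δ ≤ |(fderiv ℝ T x).det|) →
      Function.LeftInverse J T → Function.RightInverse J T →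
      ∀ i, 1 ≤ i → i ≤ k → ∀ x, ‖iteratedFDeriv ℝ i J x‖ ≤ N from h n le_rfl
  intro k
  induction k with
  | zero => exact fun _ => ⟨0, fun _ _ _ _ _ _ _ i h1 h2 => by lia⟩
  | succ k ih =>
    intro hk
    obtain ⟨N, hN⟩ := ih (by lia)
    set D : ℝ := max 1 (k.factorial * M * (max 1 N) ^ k) with hD
    refine ⟨max N (k.factorial * C * D ^ k), fun T J hT hTM hdet hl hr i hi hik x => ?_⟩
    rcases Nat.lt_or_ge i (k + 1) with hlt | hge
    · exact (hN T J hT hTM hdet hl hr i hi (by lia) x).trans (le_max_left _ _)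
    obtain rfl : i = k + 1 := le_antisymm hik hge
    have hne : ∀ y, (fderiv ℝ T y).det ≠ 0 := fun y => abs_pos.mp (hδ.trans_le (hdet y))
    have hJ : ContDiff ℝ n J := contDiff_of_inverse (by lia) hT hne hl hr
    have hn' : (n : WithTop ℕ∞) ≠ 0 := by exact_mod_cast (by lia : n ≠ 0)
    have hkn : ((k : WithTop ℕ∞) + 1) ≤ n := by exact_mod_cast hk
    have hDT : ContDiff ℝ k (fderiv ℝ T) := hT.fderiv_right hkn
    have hJk : ContDiff ℝ k J := hJ.of_le (le_self_add.trans hkn)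
    have hM : 0 ≤ M := (norm_nonneg _).trans (hTM 1 le_rfl (by lia) x)
    have hDTJ : ∀ j, 1 ≤ j → j ≤ k → ‖iteratedFDeriv ℝ j (fderiv ℝ T ∘ J) x‖ ≤ D ^ j := by
      intro j hj hjk
      have h1 : ‖iteratedFDeriv ℝ j (fderiv ℝ T ∘ J) x‖ ≤ j.factorial * M * (max 1 N) ^ j := by
        refine norm_iteratedFDeriv_comp_le hDT hJk (by exact_mod_cast hjk) x
          (fun l hlj => ?_) (fun l h1l hlj => ?_)
        · rw [norm_iteratedFDeriv_fderiv]
          exact hTM _ (by lia) (by lia) _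
        · calc _ ≤ N := hN T J hT hTM hdet hl hr l h1l (by lia) x
            _ ≤ max 1 N := le_max_right _ _
            _ ≤ _ := le_self_pow₀ (le_max_left _ _) (by lia)
      calc _ ≤ j.factorial * M * (max 1 N) ^ j := h1
        _ ≤ k.factorial * M * (max 1 N) ^ k := by
          have := Nat.factorial_le hjk
          gcongr
          exact le_max_left _ _
        _ ≤ D := le_max_right _ _
        _ ≤ D ^ j := le_self_pow₀ (le_max_left _ _) (by lia)
    refine le_trans ?_ (le_max_right _ _)
    rw [← norm_iteratedFDeriv_fderiv, fderiv_eq_ringInverse (hT.differentiable hn')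
      (hJ.differentiable hn') hr hl]
    refine norm_iteratedFDeriv_comp_le' (t := {A | A.det ≠ 0}) ?_ isOpen_det_ne_zero.uniqueDiffOn
      (contDiffOn_ringInverse_det_ne_zero k) (hDT.comp hJk) le_rfl x (fun j hj => ?_) hDTJ
    · rintro _ ⟨y, rfl⟩
      exact hne (J y)
    · refine hC _ ?_ (hdet _) j (by lia)
      have := hTM 1 le_rfl (by lia) (J x)
      rwa [norm_iteratedFDeriv_one] at this

end Inverse

/-- Under the hypotheses of Statement 0, there is a constant `N = N(n,d,K)` bounding all
partial derivatives of order `1 ≤ |ζ| ≤ n` of the inverse map `J_θ` of `T_θ(x) = x + θ·c(x)`,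
and moreover `|det DJ_θ(x)| ≤ K`. -/
theorem degenerate_SIDE_stmt1 (d n : ℕ) (hd : 1 ≤ d) (hn : 1 ≤ n) (K : ℝ) (hK : 0 < K) :
    ∃ N : ℝ, ∀ c : EuclideanSpace ℝ (Fin d) → EuclideanSpace ℝ (Fin d),
      ContDiff ℝ (n : ℕ∞) c →
      (∀ ζ : Fin d → ℕ, (∑ i, ζ i) ≤ n →
        ∀ (i : Fin d) (x : EuclideanSpace ℝ (Fin d)), |mpd ζ (fun y => c y i) x| ≤ K) →
      (∀ (x : EuclideanSpace ℝ (Fin d)), ∀ θ ∈ Set.Icc (0 : ℝ) 1,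
        K⁻¹ ≤ |((1 : Matrix (Fin d) (Fin d) ℝ) + θ • jac c x).det|) →
      ∀ θ ∈ Set.Icc (0 : ℝ) 1,
        ∀ J : EuclideanSpace ℝ (Fin d) → EuclideanSpace ℝ (Fin d),
          Function.LeftInverse J (fun x => x + θ • c x) →
          Function.RightInverse J (fun x => x + θ • c x) →
          (∀ ζ : Fin d → ℕ, 1 ≤ (∑ i, ζ i) → (∑ i, ζ i) ≤ n →
            ∀ (j : Fin d) (x : EuclideanSpace ℝ (Fin d)), |mpd ζ (fun y => J y j) x| ≤ N) ∧
          (∀ x : EuclideanSpace ℝ (Fin d), |(jac J x).det| ≤ K) := by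
  obtain ⟨N, hN⟩ := exists_bound_iteratedFDeriv_inverse (E := EuclideanSpace ℝ (Fin d)) n
    (1 + d ^ n * (d * K)) (inv_pos.mpr hK)
  refine ⟨N, fun c hc hb hdet θ hθ J hl hr => ?_⟩
  replace hc : ContDiff ℝ n c := hc
  have hn' : (n : WithTop ℕ∞) ≠ 0 := by exact_mod_cast (by lia : n ≠ 0)
  have hT : ContDiff ℝ n fun x => x + θ • c x := contDiff_id.add (hc.const_smul θ)
  have hTd := hT.differentiable hn'
  have hTdet : ∀ x, K⁻¹ ≤ |(fderiv ℝ (fun x => x + θ • c x) x).det| := fun x => by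
    rw [← det_jac (hTd x), jac_id_add_smul (hc.differentiable hn' x)]
    exact hdet x θ hθ
  have hJ : ContDiff ℝ n J := contDiff_of_inverse hn hT
    (fun x => abs_pos.mp ((inv_pos.mpr hK).trans_le (hTdet x))) hl hr
  have hJd := hJ.differentiable hn'
  refine ⟨fun ζ h1 h2 j x => ?_, fun x => ?_⟩
  · refine (abs_mpd_coord_le ζ (hJ.of_le (by exact_mod_cast h2)) j x).trans
      (hN _ J hT (fun i hi hin y => ?_) hTdet hl hr _ h1 h2 x)
    refine (norm_iteratedFDeriv_id_add_smul_le hi (hc.of_le (by exact_mod_cast hin)) hθ y).trans ?_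
    gcongr
    refine (norm_iteratedFDeriv_le_of_mpd hin hK.le hc hb y).trans ?_
    have hd' : (1 : ℝ) ≤ d := by exact_mod_cast hd
    gcongr
  · rw [det_jac (hJd x)]
    have h := congrArg ContinuousLinearMap.det
      (fderiv_comp_fderiv_of_rightInverse hTd hJd hr x)
    have h' : (fderiv ℝ (fun x => x + θ • c x) (J x)).det * (fderiv ℝ J x).det = 1 := by
      exact (map_mul LinearMap.det _ _).symm.trans (h.trans LinearMap.det_id)
    rw [← one_div_one_div K, eq_one_div_of_mul_eq_one_right h', abs_div, abs_one, one_div K]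
    exact one_div_le_one_div_of_le (inv_pos.mpr hK) (hTdet _)
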